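/- Let S be a boundaryless surface and 𝒞 a circle decomposition of S. If every C ∈ 𝒞 admits a 𝒞-annular neighborhood, then 𝒞 is upper semicontinuous. -/

import Mathlib

open Topology Set

/-- A circle in a topological space `X`: a subset homeomorphic to the unit circle. -/
def IsCircle {X : Type*} [TopologicalSpace X] (C : Set X) : Prop :=
  Nonempty (C ≃ₜ Circle)

/-- A circle decomposition of `X`: a set of pairwise disjoint circles whose union is `X`. -/
def IsCircleDecomposition {X : Type*} [TopologicalSpace X] (𝒞 : Set (Set X)) : Prop :=
  (∀ C ∈ 𝒞, IsCircle C) ∧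
  (∀ C ∈ 𝒞, ∀ D ∈ 𝒞, C ≠ D → Disjoint C D) ∧
  ⋃₀ 𝒞 = Set.univ

/-- A decomposition `𝒞` of `X` is upper semicontinuous if for every `C ∈ 𝒞` and every
open `U ⊇ C` there is an open `V ⊇ C` such that every `D ∈ 𝒞` meeting `V` lies in `U`. -/
def IsUpperSemicontinuousDecomposition {X : Type*} [TopologicalSpace X]
    (𝒞 : Set (Set X)) : Prop :=
  ∀ C ∈ 𝒞, ∀ U : Set X, IsOpen U → C ⊆ U →
    ∃ V : Set X, IsOpen V ∧ C ⊆ V ∧ ∀ D ∈ 𝒞, (D ∩ V) ≠ ∅ → D ⊆ U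

/-- A circle `C` in `S` is two-sided if there is an embedding of the annulus
`Circle × [-1,1]` into `S` carrying the middle circle onto `C`. -/
def IsTwoSided {S : Type*} [TopologicalSpace S] (C : Set S) : Prop :=
  ∃ h : Circle × Set.Icc (-1:ℝ) 1 → S, Topology.IsEmbedding h ∧
    h '' {p : Circle × Set.Icc (-1:ℝ) 1 | (p.2 : ℝ) = 0} = C

/-- A `𝒞`-annular neighborhood of a circle `C`: an embedded annulus whose middle circle
is `C`, whose image is a neighborhood of `C`, and whose two boundary circles belong
to `𝒞`. -/
def HasAnnularNbhd {S : Type*} [TopologicalSpace S] (𝒞 : Set (Set S)) (C : Set S) : Prop :=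
  ∃ h : Circle × Set.Icc (-1:ℝ) 1 → S, Topology.IsEmbedding h ∧
    h '' {p : Circle × Set.Icc (-1:ℝ) 1 | (p.2 : ℝ) = 0} = C ∧
    Set.range h ∈ nhdsSet C ∧
    h '' {p : Circle × Set.Icc (-1:ℝ) 1 | (p.2 : ℝ) = -1} ∈ 𝒞 ∧
    h '' {p : Circle × Set.Icc (-1:ℝ) 1 | (p.2 : ℝ) = 1} ∈ 𝒞


/-- A complex-valued function has a continuous logarithm. -/
def HasContinuousLog {A : Type*} [TopologicalSpace A] (f : A → ℂ) : Prop :=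
  ∃ φ : A → ℂ, Continuous φ ∧ ∀ a, Complex.exp (φ a) = f a

theorem HasContinuousLog.of_homotopy {A : Type*} [TopologicalSpace A] (H : unitInterval × A → ℂ)
    (hH : Continuous H) (h0 : ∀ p, H p ≠ 0) (hlog : HasContinuousLog fun a => H (0, a)) :
    HasContinuousLog fun a => H (1, a) := by
  obtain ⟨φ, hφ, hexp⟩ := hlog
  let H' : C(unitInterval × A, {z : ℂ // z ≠ 0}) := ⟨fun p => ⟨H p, h0 p⟩, hH.subtype_mk _⟩
  have hstart : ∀ a, H' (0, a) = ⟨Complex.exp (φ a), Complex.exp_ne_zero _⟩ :=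
    fun a => Subtype.ext (hexp a).symm
  let L := Complex.isCoveringMap_exp.liftHomotopy H' ⟨φ, hφ⟩ hstart
  refine ⟨fun a => L (1, a), by fun_prop, fun a => ?_⟩
  exact congrArg Subtype.val
    (congrFun (Complex.isCoveringMap_exp.liftHomotopy_lifts H' ⟨φ, hφ⟩ hstart) (1, a))

theorem hasContinuousLog_const {A : Type*} [TopologicalSpace A] {c : ℂ} (hc : c ≠ 0) :
    HasContinuousLog fun _ : A => c :=
  ⟨fun _ => Complex.log c, continuous_const, fun _ => Complex.exp_log hc⟩

theorem Continuous.hasContinuousLog {f : ℂ → ℂ} (hf : Continuous f) (h0 : ∀ z, f z ≠ 0) :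
    HasContinuousLog f := by
  have := HasContinuousLog.of_homotopy (A := ℂ) (fun p => f ((p.1 : ℝ) * p.2))
    (by fun_prop) (fun _ => h0 _) (by simpa using hasContinuousLog_const (h0 0))
  simpa using this

theorem eq_of_exp_eq_exp {A : Type*} [TopologicalSpace A] [PreconnectedSpace A] {φ ψ : A → ℂ}
    (hφ : Continuous φ) (hψ : Continuous ψ) (h : ∀ a, Complex.exp (φ a) = Complex.exp (ψ a))
    (a : A) (ha : φ a = ψ a) : φ = ψ :=
  Complex.isCoveringMap_exp.eq_of_comp_eq hφ hψ (funext fun x => Subtype.ext (h x)) a ha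

/-- An odd function on the circle has odd degree, hence no continuous logarithm. -/
theorem not_hasContinuousLog_of_odd {f : Circle → ℂ} (hodd : ∀ z, f (-z) = -f z) :
    ¬ HasContinuousLog f := by
  rintro ⟨φ, hφ, hexp⟩
  have key : (fun z => φ (-z)) = fun z => φ z + (φ (-1) - φ 1) := by
    refine eq_of_exp_eq_exp (by fun_prop) (by fun_prop) (fun z => ?_) 1 (by ring)
    have h1 : f 1 ≠ 0 := hexp 1 ▸ Complex.exp_ne_zero _
    rw [Complex.exp_add, Complex.exp_sub, hexp, hexp, hexp, hexp, hodd, hodd, neg_div,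
      div_self h1, mul_neg_one]
  have h1 := congrFun key (-1)
  simp only [neg_neg] at h1
  have h2 : φ (-1) = φ 1 := by linear_combination (-1 / 2) * h1
  have h3 := hodd 1
  rw [← hexp, ← hexp, h2] at h3
  exact Complex.exp_ne_zero (φ 1) (by linear_combination h3 / 2)

/-- Invariance of domain in the plane. -/
theorem image_closedBall_mem_nhds {f : ℂ → ℂ} {c : ℂ} {r : ℝ} (hr : 0 < r)
    (hf : ContinuousOn f (Metric.closedBall c r)) (hinj : InjOn f (Metric.closedBall c r)) :
    f '' Metric.closedBall c r ∈ 𝓝 (f c) := by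
  have hmem : ∀ {s : ℝ} (z : Circle), |s| ≤ 1 → c + r * s * z ∈ Metric.closedBall c r := by
    intro s z hs
    rw [Metric.mem_closedBall, dist_eq_norm]
    simp only [add_sub_cancel_left, norm_mul, Complex.norm_real, Circle.norm_coe, mul_one,
      Real.norm_eq_abs, abs_of_pos hr]
    nlinarith
  have hcirc : ¬ HasContinuousLog fun z : Circle => f (c + r * z) - f c := by
    intro h
    have hα : ∀ t : unitInterval, |1 / (1 + (t : ℝ))| ≤ 1 := fun t => by
      rw [abs_of_nonneg (by have := t.2.1; positivity), div_le_one (by linarith [t.2.1])]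
      linarith [t.2.1]
    have hβ : ∀ t : unitInterval, |-((t : ℝ) / (1 + t))| ≤ 1 := fun t => by
      rw [abs_neg, abs_of_nonneg (by have := t.2.1; positivity),
        div_le_one (by linarith [t.2.1])]
      linarith [t.2.1]
    have hne : ∀ t : unitInterval, 1 + (t : ℝ) ≠ 0 := fun t => by linarith [t.2.1]
    have := HasContinuousLog.of_homotopy (A := Circle)
      (fun p => f (c + r * (1 / (1 + (p.1 : ℝ)) : ℝ) * p.2)
        - f (c + r * (-((p.1 : ℝ) / (1 + p.1)) : ℝ) * p.2)) ?_ ?_ (by simpa using h)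
    · refine not_hasContinuousLog_of_odd (fun z => ?_) this
      have hz : ((-z : Circle) : ℂ) = -z := rfl
      rw [hz]
      norm_num
    · refine (hf.comp_continuous ?_ fun p => hmem _ (hα _)).sub
        (hf.comp_continuous ?_ fun p => hmem _ (hβ _))
      · have : Continuous fun p : unitInterval × Circle => 1 / (1 + (p.1 : ℝ)) :=
          Continuous.div (by fun_prop) (by fun_prop) fun p => hne _
        fun_prop
      · have : Continuous fun p : unitInterval × Circle => (p.1 : ℝ) / (1 + (p.1 : ℝ)) :=
          Continuous.div (by fun_prop) (by fun_prop) fun p => hne _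
        fun_prop
    · rintro ⟨t, z⟩ h0
      have := hinj (hmem z (hα t)) (hmem z (hβ t)) (sub_eq_zero.1 h0)
      have h2 : (r : ℂ) * z * ((1 / (1 + (t : ℝ)) : ℝ) + ((t : ℝ) / (1 + t) : ℝ) : ℂ) = 0 := by
        push_cast at this ⊢
        linear_combination this
      have h3 : ((1 / (1 + (t : ℝ)) : ℝ) + ((t : ℝ) / (1 + t) : ℝ) : ℂ) = 1 := by
        rw [← Complex.ofReal_add, ← add_div, div_self (hne t), Complex.ofReal_one]
      rw [h3] at h2
      simp [hr.ne'] at h2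
  have hK : IsCompact ((fun z : Circle => f (c + r * z)) '' univ) := by
    refine isCompact_univ.image (hf.comp_continuous (by fun_prop) fun z => ?_)
    simpa using hmem (s := 1) z (by simp)
  have hcK : f c ∈ ((fun z : Circle => f (c + r * z)) '' univ)ᶜ := by
    rintro ⟨z, -, hz⟩
    have := hinj (by simpa using hmem (s := 1) z (by simp)) (Metric.mem_closedBall_self hr.le) hz
    simp [hr.ne'] at this
  obtain ⟨ε, hε, hball⟩ := Metric.isOpen_iff.1 hK.isClosed.isOpen_compl _ hcK
  filter_upwards [Metric.ball_mem_nhds _ hε] with q hq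
  by_contra hqn
  apply hcirc
  have h1 := HasContinuousLog.of_homotopy (A := Circle)
    (fun p => f (c + r * (p.1 : ℝ) * p.2) - q)
    ((hf.comp_continuous (by fun_prop) fun p => hmem _ (by
      rw [abs_of_nonneg p.1.2.1]; exact p.1.2.2)).sub continuous_const)
    (fun p hp => hqn ⟨_, hmem _ (by rw [abs_of_nonneg p.1.2.1]; exact p.1.2.2), sub_eq_zero.1 hp⟩)
    (by
      simpa using hasContinuousLog_const (c := f c - q)
        (sub_ne_zero.2 fun h => hqn ⟨c, Metric.mem_closedBall_self hr.le, h⟩))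
  have h2 := HasContinuousLog.of_homotopy (A := Circle)
    (fun p => f (c + r * p.2) - (q + (p.1 : ℝ) * (f c - q)))
    ((hf.comp_continuous (by fun_prop) fun p => by simpa using hmem (s := 1) p.2 (by simp)).sub
      (by fun_prop))
    (fun p hp => hball (a := q + (p.1 : ℝ) * (f c - q)) ?_ ⟨p.2, trivial, sub_eq_zero.1 hp⟩)
    (by simpa using h1)
  · simpa using h2
  · have : Convex ℝ (Metric.ball (f c) ε) := convex_ball _ _
    have := this.add_smul_sub_mem hq (Metric.mem_ball_self hε) p.1.2
    simpa using this

/-- The closed annulus, as a cylinder over the circle. -/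
abbrev ClosedAnnulus : Type := Circle × Icc (-1 : ℝ) 1

/-- Local invariance of domain for maps from an annulus to a space with planar charts. -/
theorem image_mem_nhds_of_injective {M : Type*} [TopologicalSpace M]
    (e : OpenPartialHomeomorph M ℂ) {F : ClosedAnnulus → M} (hF : Continuous F)
    (hinj : Function.Injective F) {p : ClosedAnnulus} (hp : |(p.2 : ℝ)| < 1)
    (hpe : F p ∈ e.source) {N : Set ClosedAnnulus} (hN : N ∈ 𝓝 p) : F '' N ∈ 𝓝 (F p) := by
  let P : ℂ → ClosedAnnulus := fun w =>
    (p.1 * Circle.exp w.im, projIcc (-1) 1 (by norm_num) (p.2 + w.re))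
  have hP : Continuous P := by
    refine .prodMk ?_ (continuous_projIcc.comp ?_) <;> fun_prop
  have hP0 : P 0 = p := by simp [P, projIcc_val]
  have hnhds : P ⁻¹' (N ∩ F ⁻¹' e.source) ∈ 𝓝 (0 : ℂ) := by
    refine hP.continuousAt.preimage_mem_nhds ?_
    rw [hP0]
    exact Filter.inter_mem hN (hF.continuousAt.preimage_mem_nhds (e.open_source.mem_nhds hpe))
  obtain ⟨ρ, hρ, hball⟩ := Metric.nhds_basis_closedBall.mem_iff.1 hnhds
  set r := min ρ (min ((1 - |(p.2 : ℝ)|) / 2) 1)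
  have hr0 : 0 < r := lt_min hρ (lt_min (by linarith) one_pos)
  have hsub : Metric.closedBall (0 : ℂ) r ⊆ P ⁻¹' (N ∩ F ⁻¹' e.source) :=
    (Metric.closedBall_subset_closedBall (min_le_left _ _)).trans hball
  have hbd : ∀ w ∈ Metric.closedBall (0 : ℂ) r,
      (p.2 : ℝ) + w.re ∈ Icc (-1 : ℝ) 1 ∧ |w.im| ≤ 1 := by
    intro w hw
    rw [mem_closedBall_zero_iff] at hw
    have h1 := abs_le.1 ((Complex.abs_re_le_norm w).trans hw)
    have h2 := (Complex.abs_im_le_norm w).trans hw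
    have h3 : r ≤ (1 - |(p.2 : ℝ)|) / 2 := (min_le_right _ _).trans (min_le_left _ _)
    have h4 : r ≤ 1 := (min_le_right _ _).trans (min_le_right _ _)
    have h5 := abs_le.1 (le_refl |(p.2 : ℝ)|)
    exact ⟨⟨by linarith, by linarith⟩, h2.trans h4⟩
  have hPinj : InjOn P (Metric.closedBall 0 r) := by
    intro w hw w' hw' h
    obtain ⟨h1, h2⟩ := Prod.ext_iff.1 h
    have hre : w.re = w'.re := by
      simp only [P, projIcc_of_mem _ (hbd w hw).1, projIcc_of_mem _ (hbd w' hw').1,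
        Subtype.mk.injEq, add_right_inj] at h2
      exact h2
    have him : w.im = w'.im :=
      Circle.exp_injOn_Icc (a := -1) (b := 1) (by linarith [Real.pi_gt_three])
        (abs_le.1 (hbd w hw).2) (abs_le.1 (hbd w' hw').2) (mul_left_cancel h1)
    exact Complex.ext hre him
  have hcont : ContinuousOn (fun w => e (F (P w))) (Metric.closedBall 0 r) :=
    e.continuousOn.comp (hF.comp hP).continuousOn fun w hw => (hsub hw).2
  have himg := image_closedBall_mem_nhds hr0 hcont fun w hw w' hw' h =>
    hPinj hw hw' (hinj (e.injOn (hsub hw).2 (hsub hw').2 h))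
  rw [hP0] at himg
  filter_upwards [e.open_source.mem_nhds hpe, (e.continuousAt hpe).preimage_mem_nhds himg]
    with x hx ⟨w, hw, hwx⟩
  exact ⟨P w, (hsub hw).1, e.injOn (hsub hw).2 hx hwx⟩

theorem isOpen_image_of_injective {M : Type*} [TopologicalSpace M]
    (hM : ∀ x : M, ∃ e : OpenPartialHomeomorph M ℂ, x ∈ e.source) {F : ClosedAnnulus → M}
    (hF : Continuous F) (hinj : Function.Injective F) {N : Set ClosedAnnulus} (hN : IsOpen N)
    (hN1 : ∀ p ∈ N, |(p.2 : ℝ)| < 1) : IsOpen (F '' N) := by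
  rw [isOpen_iff_mem_nhds]
  rintro _ ⟨p, hp, rfl⟩
  obtain ⟨e, he⟩ := hM (F p)
  exact image_mem_nhds_of_injective e hF hinj (hN1 p hp) he (hN.mem_nhds hp)

theorem exists_planar_chart {S : Type*} [TopologicalSpace S]
    [ChartedSpace (EuclideanSpace ℝ (Fin 2)) S] (x : S) :
    ∃ e : OpenPartialHomeomorph S ℂ, x ∈ e.source :=
  ⟨(chartAt (EuclideanSpace ℝ (Fin 2)) x).transHomeomorph
    Complex.orthonormalBasisOneI.repr.symm.toHomeomorph, mem_chart_source _ x⟩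

/-- The core of an annulus embedded in the plane separates the plane. -/
theorem not_isPreconnected_compl_core {f : ClosedAnnulus → ℂ} (hf : Continuous f)
    (hinj : Function.Injective f) :
    ¬ IsPreconnected (f '' {p : ClosedAnnulus | (p.2 : ℝ) = 0})ᶜ := by
  intro hconn
  have hcl : IsClosedEmbedding f := hf.isClosedEmbedding hinj
  let v : ClosedAnnulus → ℂ := fun p => Complex.exp ((Real.pi * (p.2 : ℝ) : ℝ) * Complex.I)
  have hv : Continuous v := by fun_prop
  let u : ℂ → ℂ := Function.extend f v fun _ => -1
  have hu : ∀ p, u (f p) = v p := fun p => hinj.extend_apply _ _ _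
  have hu' : ∀ w, w ∉ range f → u w = -1 := fun w hw => Function.extend_apply' _ _ _ hw
  have hv1 : ∀ p : ClosedAnnulus, ¬ |(p.2 : ℝ)| < 1 → v p = -1 := by
    intro p hp
    have hb := p.2.2
    have : (p.2 : ℝ) = 1 ∨ (p.2 : ℝ) = -1 := by
      rcases le_total 0 (p.2 : ℝ) with h | h
      · rw [abs_of_nonneg h] at hp
        exact .inl (le_antisymm hb.2 (not_lt.1 hp))
      · rw [abs_of_nonpos h] at hp
        exact .inr (le_antisymm (by linarith) hb.1)
    rcases this with h | h
    · simp [v, h]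
    · simp [v, h, Complex.exp_neg]
  have hopen : IsOpen (f '' {p : ClosedAnnulus | |(p.2 : ℝ)| < 1}) :=
    isOpen_image_of_injective (fun x => ⟨.refl ℂ, trivial⟩) hf hinj
      (isOpen_lt (by fun_prop) continuous_const) fun _ h => h
  have hcontu : Continuous u := by
    rw [← continuousOn_univ, ← union_compl_self (f '' {p : ClosedAnnulus | |(p.2 : ℝ)| < 1})]
    refine ContinuousOn.mono (s := range f ∪ _) ?_
      (union_subset_union_left _ (image_subset_range _ _))
    refine ContinuousOn.union_of_isClosed ?_ ?_ hcl.isClosed_range hopen.isClosed_compl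
    · rw [continuousOn_iff_continuous_domRestrict,
        ← hcl.isEmbedding.toHomeomorph.comp_continuous_iff']
      convert hv using 1
      exact funext hu
    · refine continuousOn_const.congr (f := fun _ => (-1 : ℂ)) fun w hw => ?_
      by_cases hr : w ∈ range f
      · obtain ⟨p, rfl⟩ := hr
        rw [hu, hv1 p fun h => hw ⟨p, h, rfl⟩]
      · exact hu' w hr
  have hnorm : ∀ w, ‖u w‖ = 1 := by
    intro w
    by_cases hr : w ∈ range f
    · obtain ⟨p, rfl⟩ := hr
      rw [hu]
      exact Complex.norm_exp_ofReal_mul_I _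
    · rw [hu' w hr, norm_neg, norm_one]
  obtain ⟨φ, hφ, hexp⟩ := hcontu.hasContinuousLog fun z h => by
    have := hnorm z
    simp [h] at this
  have hre : ∀ w, (φ w).re = 0 := fun w => by
    have := hnorm w
    rwa [← hexp, Complex.norm_exp, Real.exp_eq_one_iff] at this
  let o : Icc (-1 : ℝ) 1 := ⟨0, by norm_num⟩
  have hv0 : v (1, o) = 1 := by simp [v, o]
  have key : (fun t : Icc (-1 : ℝ) 1 => φ (f (1, t))) =
      fun t : Icc (-1 : ℝ) 1 => (Real.pi * (t : ℝ) : ℝ) * Complex.I + φ (f (1, o)) := by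
    have : PreconnectedSpace (Icc (-1 : ℝ) 1) := Subtype.preconnectedSpace isPreconnected_Icc
    refine eq_of_exp_eq_exp (by fun_prop) (by fun_prop) (fun t => ?_) o (by simp [o])
    rw [hexp, hu, Complex.exp_add, hexp, hu, hv0, mul_one]
  have hlog : ∀ t, (φ (f (1, t)) - φ (f (1, o))).im = Real.pi * t := fun t => by
    rw [congrFun key t, add_sub_cancel_right, Complex.im_ofReal_mul, Complex.I_im, mul_one]
  have hmem : ∀ t : Icc (-1 : ℝ) 1, (t : ℝ) ≠ 0 →
      f (1, t) ∈ (f '' {p : ClosedAnnulus | (p.2 : ℝ) = 0})ᶜ := by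
    rintro t ht ⟨q, hq, hqt⟩
    rw [hinj hqt] at hq
    exact ht hq
  have himg := hconn.image (fun w => (φ w - φ (f (1, o))).im) (by fun_prop)
  obtain ⟨w, hw, hw0⟩ := himg.ordConnected.out
    ⟨_, hmem ⟨-1, by norm_num⟩ (by norm_num), hlog _⟩
    ⟨_, hmem ⟨1, by norm_num⟩ (by norm_num), hlog _⟩
    (show (0 : ℝ) ∈ Icc _ _ by constructor <;> simp [Real.pi_pos.le])
  have hφw : φ w = φ (f (1, o)) := by
    rw [← sub_eq_zero]
    exact Complex.ext (by simp [hre]) hw0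
  have huw : u w = 1 := by rw [← hexp, hφw, hexp, hu, hv0]
  by_cases hr : w ∈ range f
  · obtain ⟨p, rfl⟩ := hr
    rw [hu] at huw
    obtain ⟨n, hn⟩ := Complex.exp_eq_one_iff.1 huw
    have h1 : (p.2 : ℝ) = 2 * n := by
      have h2 := congrArg Complex.im hn
      simp at h2
      have := Real.pi_pos.ne'
      field_simp at h2
      linarith
    have hb := p.2.2
    rw [h1] at hb
    have h3 : (-1 : ℤ) ≤ 2 * n := by exact_mod_cast hb.1
    have h4 : 2 * n ≤ (1 : ℤ) := by exact_mod_cast hb.2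
    have hn0 : n = 0 := by omega
    exact hw ⟨p, by simp [h1, hn0], rfl⟩
  · rw [hu' w hr] at huw
    norm_num at huw

/-- The union of a planar set with the bounded components of its complement. -/
def planarHull (K : Set ℂ) : Set ℂ :=
  {z | Bornology.IsBounded (connectedComponentIn Kᶜ z)}

theorem mem_planarHull {K : Set ℂ} {z : ℂ} :
    z ∈ planarHull K ↔ Bornology.IsBounded (connectedComponentIn Kᶜ z) :=
  Iff.rfl

theorem subset_planarHull (K : Set ℂ) : K ⊆ planarHull K := fun z hz => by
  simp [planarHull, connectedComponentIn_eq_empty (F := Kᶜ) (not_not.2 hz)]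

theorem IsPreconnected.subset_planarHull {A K : Set ℂ} (hA : IsPreconnected A)
    (hAK : Disjoint A K) {x : ℂ} (hx : x ∈ A) (hxK : x ∈ planarHull K) : A ⊆ planarHull K := by
  intro y hy
  have hsub := hA.subset_connectedComponentIn hx hAK.subset_compl_right
  rw [mem_planarHull, ← connectedComponentIn_eq (hsub hy)]
  exact hxK

theorem planarHull_subset_planarHull {K L : Set ℂ} (h : K ⊆ planarHull L) :
    planarHull K ⊆ planarHull L := by
  intro z hz
  by_contra hzL
  have hzL' : z ∈ Lᶜ := fun h' => hzL (subset_planarHull L h')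
  refine hzL (mem_planarHull.2 <| (mem_planarHull.1 hz).subset <|
    isPreconnected_connectedComponentIn.subset_connectedComponentIn
      (mem_connectedComponentIn hzL') fun y hy hyK => hzL ?_)
  have := h hyK
  rwa [mem_planarHull, ← connectedComponentIn_eq hy] at this

theorem isOpen_planarHull_diff {K : Set ℂ} (hK : IsClosed K) : IsOpen (planarHull K \ K) := by
  rw [isOpen_iff_mem_nhds]
  rintro z ⟨hz, hzK⟩
  filter_upwards [(hK.isOpen_compl.connectedComponentIn (x := z)).mem_nhds
    (mem_connectedComponentIn hzK)] with y hy
  refine ⟨?_, connectedComponentIn_subset _ _ hy⟩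
  rwa [mem_planarHull, ← connectedComponentIn_eq hy]

theorem isClosed_planarHull {K : Set ℂ} (hK : IsClosed K) : IsClosed (planarHull K) := by
  rw [← isOpen_compl_iff, isOpen_iff_mem_nhds]
  intro z hz
  have hzK : z ∈ Kᶜ := fun h => hz (subset_planarHull K h)
  filter_upwards [(hK.isOpen_compl.connectedComponentIn (x := z)).mem_nhds
    (mem_connectedComponentIn hzK)] with y hy
  rwa [mem_compl_iff, mem_planarHull, ← connectedComponentIn_eq hy]

theorem planarHull_subset_ball {K : Set ℂ} {R : ℝ} (hK : K ⊆ Metric.ball 0 R) :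
    planarHull K ⊆ Metric.ball 0 R := by
  intro z hz
  by_contra hzR
  rw [mem_ball_zero_iff, not_lt] at hzR
  rcases le_or_gt R 0 with hR | hR
  · rw [Metric.ball_eq_empty.2 hR, subset_empty_iff] at hK
    rw [mem_planarHull, hK, compl_empty, connectedComponentIn_univ,
      PreconnectedSpace.connectedComponent_eq_univ] at hz
    exact NormedSpace.unbounded_univ ℝ ℂ hz
  have hz0 : 0 < ‖z‖ := hR.trans_le hzR
  have hray : IsPreconnected ((fun t : ℝ => (t : ℂ) * z) '' Ici 1) :=
    isPreconnected_Ici.image _ (by fun_prop)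
  have hsub := hray.subset_connectedComponentIn (x := z) (F := Kᶜ) ⟨1, by simp, by simp⟩ (by
    rintro _ ⟨t, ht, rfl⟩ htK
    have ht1 : (1 : ℝ) ≤ t := ht
    have := mem_ball_zero_iff.1 (hK htK)
    rw [norm_mul, Complex.norm_real, Real.norm_eq_abs, abs_of_pos (by linarith)] at this
    nlinarith)
  obtain ⟨C, hC⟩ := ((mem_planarHull.1 hz).subset hsub).exists_norm_le
  have h1 := hC _ ⟨|C| / ‖z‖ + 1, by simp only [mem_Ici, le_add_iff_nonneg_left]; positivity, rfl⟩
  rw [norm_mul, Complex.norm_real, Real.norm_eq_abs, abs_of_nonneg (by positivity), add_mul,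
    div_mul_cancel₀ _ hz0.ne'] at h1
  linarith [le_abs_self C]

theorem isCompact_planarHull {K : Set ℂ} (hK : IsCompact K) : IsCompact (planarHull K) := by
  obtain ⟨R, hR⟩ := hK.isBounded.subset_ball 0
  exact Metric.isCompact_of_isClosed_isBounded (isClosed_planarHull hK.isClosed)
    (Metric.isBounded_ball.subset (planarHull_subset_ball hR))

theorem isPreconnected_compl_closedBall {R : ℝ} (hR : 0 ≤ R) :
    IsPreconnected (Metric.closedBall (0 : ℂ) R)ᶜ := by
  have : (Metric.closedBall (0 : ℂ) R)ᶜ =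
      (fun p : ℝ × Circle => (p.1 : ℂ) * p.2) '' (Ioi R ×ˢ univ) := by
    ext z
    simp only [mem_compl_iff, mem_closedBall_zero_iff, not_le, mem_image, mem_prod, mem_Ioi,
      mem_univ, and_true, Prod.exists]
    constructor
    · intro hz
      refine ⟨‖z‖, Circle.exp z.arg, hz, ?_⟩
      rw [Circle.coe_exp, Complex.norm_mul_exp_arg_mul_I]
    · rintro ⟨r, c, hr, rfl⟩
      rwa [norm_mul, Circle.norm_coe, mul_one, Complex.norm_real, Real.norm_eq_abs,
        abs_of_pos (hR.trans_lt hr)]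
  rw [this]
  exact (isPreconnected_Ioi.prod isPreconnected_univ).image _ (by fun_prop)

theorem planarHull_diff_nonempty {K : Set ℂ} (hK : IsCompact K) (hsep : ¬ IsPreconnected Kᶜ) :
    (planarHull K \ K).Nonempty := by
  by_contra hempty
  rw [not_nonempty_iff_eq_empty, sdiff_eq_empty] at hempty
  apply hsep
  obtain ⟨R, hR0, hR⟩ := hK.isBounded.subset_closedBall_lt 0 0
  have hunb : ∀ z ∈ Kᶜ, ∃ y ∈ connectedComponentIn Kᶜ z, y ∈ (Metric.closedBall (0 : ℂ) R)ᶜ := by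
    intro z hz
    by_contra! h
    exact hz (hempty (Metric.isBounded_closedBall.subset fun y hy => not_not.1 (h y hy)))
  refine isPreconnected_of_forall_pair fun a ha b hb => ?_
  obtain ⟨a', ha', haR⟩ := hunb a ha
  obtain ⟨b', hb', hbR⟩ := hunb b hb
  have h1 := isPreconnected_connectedComponentIn.union a' ha' haR
    (isPreconnected_compl_closedBall hR0.le)
  have h2 := h1.union b' (Or.inr hbR) hb' isPreconnected_connectedComponentIn
  exact ⟨_, union_subset (union_subset (connectedComponentIn_subset _ _)
    (compl_subset_compl.2 hR)) (connectedComponentIn_subset _ _),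
    .inl (.inl (mem_connectedComponentIn ha)), .inr (mem_connectedComponentIn hb), h2⟩

/-- Two disjoint compact sets cannot each lie in the hull of the other. -/
theorem not_subset_planarHull_of_subset {K L : Set ℂ} (hK : IsCompact K) (hL : IsCompact L)
    (hne : K.Nonempty) (hd : Disjoint K L) (hKL : K ⊆ planarHull L) : ¬ L ⊆ planarHull K := by
  intro hLK
  have hcomp := (isCompact_planarHull hK).union (isCompact_planarHull hL)
  have heq : planarHull K ∪ planarHull L = (planarHull K \ K) ∪ (planarHull L \ L) := by
    refine Subset.antisymm ?_ (union_subset_union sdiff_subset sdiff_subset)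
    rintro z (hz | hz)
    · by_cases h : z ∈ K
      · exact .inr ⟨hKL h, hd.notMem_of_mem_left h⟩
      · exact .inl ⟨hz, h⟩
    · by_cases h : z ∈ L
      · exact .inl ⟨hLK h, hd.notMem_of_mem_right h⟩
      · exact .inr ⟨hz, h⟩
  have hopen : IsOpen (planarHull K ∪ planarHull L) := by
    rw [heq]
    exact (isOpen_planarHull_diff hK.isClosed).union (isOpen_planarHull_diff hL.isClosed)
  have huniv := IsClopen.eq_univ ⟨hcomp.isClosed, hopen⟩
    (hne.mono ((subset_planarHull K).trans subset_union_left))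
  rw [huniv] at hcomp
  exact noncompact_univ ℂ hcomp

/-- A pairwise disjoint family of planar continua, each of which separates the plane. -/
structure IsSeparatingFamily (𝒟 : Set (Set ℂ)) : Prop where
  isCompact : ∀ D ∈ 𝒟, IsCompact D
  isConnected : ∀ D ∈ 𝒟, IsConnected D
  disjoint : ∀ D ∈ 𝒟, ∀ E ∈ 𝒟, D ≠ E → Disjoint D E
  not_isPreconnected_compl : ∀ D ∈ 𝒟, ¬ IsPreconnected Dᶜ

namespace IsSeparatingFamily

theorem subset_planarHull {𝒟 : Set (Set ℂ)} (h𝒟 : IsSeparatingFamily 𝒟)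
    {D E : Set ℂ} (hD : D ∈ 𝒟) (hE : E ∈ 𝒟) {x : ℂ} (hx : x ∈ D)
    (hxE : x ∈ planarHull E) : D ⊆ planarHull E := by
  by_cases h : D = E
  · exact h ▸ _root_.subset_planarHull D
  · exact (h𝒟.isConnected D hD).isPreconnected.subset_planarHull (h𝒟.disjoint D hD E hE h) hx hxE

theorem eq_of_subset_planarHull {𝒟 : Set (Set ℂ)} (h𝒟 : IsSeparatingFamily 𝒟)
    {D E : Set ℂ} (hD : D ∈ 𝒟) (hE : E ∈ 𝒟)
    (hDE : D ⊆ planarHull E) (hED : E ⊆ planarHull D) : D = E := by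
  by_contra h
  exact not_subset_planarHull_of_subset (h𝒟.isCompact D hD) (h𝒟.isCompact E hE)
    (h𝒟.isConnected D hD).nonempty (h𝒟.disjoint D hD E hE h) hDE hED

/-- A separating family never fills the hull of one of its members. -/
theorem not_planarHull_subset_sUnion {𝒟 : Set (Set ℂ)} (h𝒟 : IsSeparatingFamily 𝒟)
    {D : Set ℂ} (hD : D ∈ 𝒟) : ¬ planarHull D ⊆ ⋃₀ 𝒟 := by
  intro hcov
  obtain ⟨m, ⟨E, hE, rfl, hED⟩, hmin⟩ := zorn_superset
    {K | ∃ E ∈ 𝒟, planarHull E = K ∧ K ⊆ planarHull D} (fun c hc hchain => by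
      rcases c.eq_empty_or_nonempty with rfl | hcne
      · exact ⟨_, ⟨D, hD, rfl, Subset.rfl⟩, by simp⟩
      have hcomp : ∀ K ∈ c, IsCompact K := fun K hK => by
        obtain ⟨E, hE, rfl, -⟩ := hc hK
        exact isCompact_planarHull (h𝒟.isCompact E hE)
      have hne : ∀ K ∈ c, K.Nonempty := fun K hK => by
        obtain ⟨E, hE, rfl, -⟩ := hc hK
        exact (h𝒟.isConnected E hE).nonempty.mono (_root_.subset_planarHull E)
      have : Nonempty c := hcne.to_subtype
      obtain ⟨x, hx⟩ := IsCompact.nonempty_sInter_of_directed_nonempty_isCompact_isClosed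
        (fun K hK L hL => (hchain.total hK hL).elim (fun h => ⟨K, hK, Subset.rfl, h⟩)
          fun h => ⟨L, hL, h, Subset.rfl⟩) hne hcomp fun K hK => (hcomp K hK).isClosed
      obtain ⟨K₀, hK₀⟩ := hcne
      obtain ⟨E₀, -, -, hE₀D⟩ := hc hK₀
      obtain ⟨F, hF, hxF⟩ := hcov (hE₀D (hx K₀ hK₀))
      have hlb : ∀ K ∈ c, planarHull F ⊆ K := fun K hK => by
        have hxK := hx K hK
        obtain ⟨E, hE, rfl, -⟩ := hc hK
        exact planarHull_subset_planarHull (h𝒟.subset_planarHull hF hE hxF hxK)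
      exact ⟨_, ⟨F, hF, rfl, (hlb K₀ hK₀).trans hE₀D⟩, hlb⟩)
  obtain ⟨x, hx, hxE⟩ := planarHull_diff_nonempty (h𝒟.isCompact E hE)
    (h𝒟.not_isPreconnected_compl E hE)
  obtain ⟨F, hF, hxF⟩ := hcov (hED hx)
  have hFE := h𝒟.subset_planarHull hF hE hxF hx
  have hsub := planarHull_subset_planarHull hFE
  have hEF := (_root_.subset_planarHull E).trans (hmin ⟨F, hF, rfl, hsub.trans hED⟩ hsub)
  exact hxE (h𝒟.eq_of_subset_planarHull hF hE hFE hEF ▸ hxF)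

/-- If a separating family partitions an open round annulus, its members close to the inner
boundary circle stay close to it. -/
theorem exists_forall_subset_ball {𝒟 : Set (Set ℂ)} (h𝒟 : IsSeparatingFamily 𝒟)
    (hsub : ∀ D ∈ 𝒟, ∀ z ∈ D, 2 < ‖z‖ ∧ ‖z‖ < 3)
    (hcov : ∀ z : ℂ, 2 < ‖z‖ → ‖z‖ < 3 → z ∈ ⋃₀ 𝒟) {ε : ℝ} (hε : 0 < ε) :
    ∃ δ > 0, ∀ D ∈ 𝒟, ∀ z ∈ D, ‖z‖ < 2 + δ → ∀ w ∈ D, ‖w‖ < 2 + ε := by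
  have hdisj : ∀ D ∈ 𝒟, Disjoint (Metric.closedBall (0 : ℂ) 2) D := fun D hD =>
    disjoint_left.2 fun z hz hzD => (mem_closedBall_zero_iff.1 hz).not_gt (hsub D hD z hzD).1
  have hball : ∀ D ∈ 𝒟, planarHull D ⊆ Metric.ball 0 3 := fun D hD =>
    planarHull_subset_ball fun z hz => mem_ball_zero_iff.2 (hsub D hD z hz).2
  have hinner : ∀ D ∈ 𝒟, Metric.closedBall (0 : ℂ) 2 ⊆ planarHull D := by
    intro D hD
    by_contra hnot
    refine h𝒟.not_planarHull_subset_sUnion hD fun z hz =>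
      hcov z ?_ (mem_ball_zero_iff.1 (hball D hD hz))
    by_contra hz2
    exact hnot ((convex_closedBall (0 : ℂ) 2).isPreconnected.subset_planarHull (hdisj D hD)
      (mem_closedBall_zero_iff.2 (not_lt.1 hz2)) hz)
  have hinner' : ∀ D ∈ 𝒟, Metric.closedBall (0 : ℂ) 2 ⊆ planarHull D \ D := fun D hD =>
    subset_sdiff.2 ⟨hinner D hD, hdisj D hD⟩
  have hInter : ∀ x : ℂ, 2 < ‖x‖ → ‖x‖ < 3 → ∃ D ∈ 𝒟, x ∉ planarHull D := by
    intro x hx2 hx3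
    by_contra! hx
    obtain ⟨D, hD, hxD⟩ := hcov x hx2 hx3
    obtain ⟨η, hη, hηD⟩ := Metric.isOpen_iff.1
      (isOpen_planarHull_diff (h𝒟.isCompact D hD).isClosed) 2 (hinner' D hD (by simp))
    obtain ⟨t, ht0, ht⟩ := exists_between (lt_min hη one_pos)
    have htη : t < η := ht.trans_le (min_le_left _ _)
    have ht1 : t < 1 := ht.trans_le (min_le_right _ _)
    have hnorm : ‖((2 + t : ℝ) : ℂ)‖ = 2 + t := by
      rw [Complex.norm_real, Real.norm_eq_abs, abs_of_pos (by linarith)]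
    have hyD := @hηD ((2 + t : ℝ) : ℂ) (by simpa [dist_eq_norm, abs_of_pos ht0] using htη)
    obtain ⟨E, hE, hyE⟩ := hcov ((2 + t : ℝ) : ℂ) (by linarith) (by linarith)
    have hED := h𝒟.subset_planarHull hE hD hyE hyD.1
    have hDE := h𝒟.subset_planarHull hD hE hxD (hx E hE)
    exact hyD.2 (h𝒟.eq_of_subset_planarHull hE hD hED hDE ▸ hyE)
  have hKcomp : IsCompact (Metric.closedBall (0 : ℂ) 3 \ Metric.ball 0 (2 + ε)) :=
    (isCompact_closedBall 0 3).diff Metric.isOpen_ball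
  obtain ⟨D₀, hD₀, -⟩ := hcov (5 / 2) (by norm_num) (by norm_num)
  obtain ⟨t, ht⟩ := hKcomp.elim_finite_subfamily_closed (fun D : 𝒟 => planarHull D)
    (fun D => isClosed_planarHull (h𝒟.isCompact D D.2).isClosed) (by
      rw [eq_empty_iff_forall_notMem]
      rintro x ⟨⟨-, hx⟩, hxD⟩
      rw [mem_iInter] at hxD
      rw [mem_ball_zero_iff, not_lt] at hx
      obtain ⟨D, hD, hnot⟩ := hInter x (by linarith)
        (mem_ball_zero_iff.1 (hball D₀ hD₀ (hxD ⟨D₀, hD₀⟩)))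
      exact hnot (hxD ⟨D, hD⟩))
  have hO : IsOpen (⋂ D ∈ t, planarHull (D : Set ℂ) \ D) := isOpen_biInter_finset fun D _ =>
    isOpen_planarHull_diff (h𝒟.isCompact D D.2).isClosed
  obtain ⟨δ, hδ, hδO⟩ := (isCompact_closedBall (0 : ℂ) 2).exists_thickening_subset_open hO
    (subset_iInter₂ fun D _ => hinner' D D.2)
  rw [thickening_closedBall hδ (by norm_num)] at hδO
  refine ⟨δ, hδ, fun D hD z hz hzδ w hw => ?_⟩
  by_contra hwε
  have hzO := hδO (mem_ball_zero_iff.2 (hzδ.trans_eq (add_comm _ _)))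
  have : w ∈ (Metric.closedBall (0 : ℂ) 3 \ Metric.ball 0 (2 + ε)) ∩
      ⋂ i ∈ t, planarHull (i : Set ℂ) := by
    refine ⟨⟨mem_closedBall_zero_iff.2 (hsub D hD w hw).2.le,
      fun h => hwε (mem_ball_zero_iff.1 h)⟩, mem_iInter₂.2 fun E hE => ?_⟩
    exact h𝒟.subset_planarHull hD E.2 hz (mem_iInter₂.1 hzO E hE).1 hw
  rw [ht] at this
  exact this

end IsSeparatingFamily

/-- The embedding of the cylinder as the round annulus with radii `1` and `3`. -/
def roundAnnulus (p : ClosedAnnulus) : ℂ := ((2 + p.2 : ℝ) : ℂ) * p.1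

theorem continuous_roundAnnulus : Continuous roundAnnulus := by
  unfold roundAnnulus
  fun_prop

theorem norm_roundAnnulus (p : ClosedAnnulus) : ‖roundAnnulus p‖ = 2 + p.2 := by
  rw [roundAnnulus, norm_mul, Circle.norm_coe, mul_one, Complex.norm_real, Real.norm_eq_abs,
    abs_of_pos (by linarith [p.2.2.1])]

theorem roundAnnulus_injective : Function.Injective roundAnnulus := by
  intro p q hpq
  have h2 : (p.2 : ℝ) = q.2 := by
    have := congrArg norm hpq
    rw [norm_roundAnnulus, norm_roundAnnulus] at this
    linarith
  have hne : ((2 + q.2 : ℝ) : ℂ) ≠ 0 := Complex.ofReal_ne_zero.2 (by linarith [q.2.2.1])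
  rw [roundAnnulus, roundAnnulus, h2] at hpq
  exact Prod.ext (Circle.ext (mul_left_cancel₀ hne hpq)) (Subtype.ext h2)

theorem exists_roundAnnulus_eq {z : ℂ} (h1 : 1 ≤ ‖z‖) (h3 : ‖z‖ ≤ 3) :
    ∃ p, roundAnnulus p = z := by
  refine ⟨(Circle.exp z.arg, ⟨‖z‖ - 2, by linarith, by linarith⟩), ?_⟩
  simp only [roundAnnulus, add_sub_cancel, Circle.coe_exp, Complex.norm_mul_exp_arg_mul_I]

theorem IsCircle.isCompact {X : Type*} [TopologicalSpace X] {C : Set X} (hC : IsCircle C) :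
    IsCompact C := by
  obtain ⟨e⟩ := hC
  exact isCompact_iff_compactSpace.2 e.symm.compactSpace

theorem IsCircle.isConnected {X : Type*} [TopologicalSpace X] {C : Set X} (hC : IsCircle C) :
    IsConnected C := by
  obtain ⟨e⟩ := hC
  exact isConnected_iff_connectedSpace.2 (e.symm.surjective.connectedSpace e.symm.continuous)

theorem exists_forall_abs_lt_mem {N : Set ClosedAnnulus} (hN : IsOpen N)
    (h0 : {p : ClosedAnnulus | (p.2 : ℝ) = 0} ⊆ N) :
    ∃ ε > 0, ∀ p : ClosedAnnulus, |(p.2 : ℝ)| < ε → p ∈ N := by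
  obtain ⟨u, v, -, hv, hu, h0v, huv⟩ := generalized_tube_lemma (isCompact_univ (X := Circle))
    (isCompact_singleton (x := (⟨0, by norm_num⟩ : Icc (-1 : ℝ) 1))) hN (by
      rintro ⟨z, t⟩ ⟨-, rfl⟩
      exact h0 rfl)
  obtain ⟨ε, hε, hball⟩ := Metric.isOpen_iff.1 hv _ (h0v rfl)
  refine ⟨ε, hε, fun p hp => huv ⟨hu trivial, hball ?_⟩⟩
  simpa [Subtype.dist_eq, Real.dist_eq] using hp

/-- A circle with an annular neighborhood, pulled back to a round planar annulus containing it,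
separates the plane. -/
theorem HasAnnularNbhd.not_isPreconnected_compl {S : Type*} [TopologicalSpace S]
    {𝒞 : Set (Set S)} {D : Set S} (hD : HasAnnularNbhd 𝒞 D) {h : ClosedAnnulus → S}
    (hh : IsEmbedding h) {N : Set ClosedAnnulus} (hN : IsOpen (h '' N)) (hDN : D ⊆ h '' N) :
    ¬ IsPreconnected (roundAnnulus '' (h ⁻¹' D))ᶜ := by
  obtain ⟨g, hg, rfl, -⟩ := hD
  obtain ⟨ε, hε, hεN⟩ := exists_forall_abs_lt_mem (hN.preimage hg.continuous)
    (image_subset_iff.1 hDN)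
  set r := min ε 1 / 2
  have hr0 : 0 < r := half_pos (lt_min hε one_pos)
  have hrε : r < ε := (half_lt_self (lt_min hε one_pos)).trans_le (min_le_left _ _)
  have hr1 : r < 1 := (half_lt_self (lt_min hε one_pos)).trans_le (min_le_right _ _)
  have hrt : ∀ t : Icc (-1 : ℝ) 1, |r * t| ≤ r := fun t => by
    rw [abs_mul, abs_of_pos hr0]
    exact mul_le_of_le_one_right hr0.le (abs_le.2 t.2)
  let σ : ClosedAnnulus → ClosedAnnulus := fun p =>
    (p.1, ⟨r * p.2, abs_le.1 ((hrt p.2).trans hr1.le)⟩)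
  have hσ : Continuous σ := by fun_prop
  have hσinj : Function.Injective σ := by
    intro p q hpq
    simp only [σ, Prod.mk.injEq] at hpq
    exact Prod.ext hpq.1 (Subtype.ext (mul_left_cancel₀ hr0.ne' (congrArg Subtype.val hpq.2)))
  choose F hFN hF using fun p => hεN (σ p) ((hrt p.2).trans_lt hrε)
  have hFcont : Continuous F := hh.continuous_iff.2 (by
    rw [show h ∘ F = g ∘ σ from funext hF]
    exact hg.continuous.comp hσ)
  have hFinj : Function.Injective F := fun p q hpq =>
    hσinj (hg.injective (by rw [← hF, ← hF, hpq]))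
  have hcore : roundAnnulus '' (h ⁻¹' (g '' {p : ClosedAnnulus | (p.2 : ℝ) = 0})) =
      (roundAnnulus ∘ F) '' {p : ClosedAnnulus | (p.2 : ℝ) = 0} := by
    rw [image_comp]
    congr 1
    ext q
    constructor
    · rintro ⟨p, hp, hpq⟩
      have hp0 : (p.2 : ℝ) = 0 := hp
      have hσp : σ p = p := Prod.ext rfl (Subtype.ext (by simp [σ, hp0]))
      exact ⟨p, hp, hh.injective (by rw [hF, hσp, hpq])⟩
    · rintro ⟨p, hp, rfl⟩
      have hp0 : (p.2 : ℝ) = 0 := hp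
      exact ⟨σ p, by simp [σ, hp0], (hF p).symm⟩
  rw [hcore]
  exact not_isPreconnected_compl_core (continuous_roundAnnulus.comp hFcont)
    (roundAnnulus_injective.comp hFinj)

theorem IsCircleDecomposition.exists_forall_subset_of_embedding {S : Type*} [TopologicalSpace S]
    [T2Space S] [ChartedSpace (EuclideanSpace ℝ (Fin 2)) S] {𝒞 : Set (Set S)}
    (h𝒞 : IsCircleDecomposition 𝒞) (hann : ∀ C ∈ 𝒞, HasAnnularNbhd 𝒞 C) {h : ClosedAnnulus → S}
    (hh : IsEmbedding h) (h0 : h '' {p : ClosedAnnulus | (p.2 : ℝ) = 0} ∈ 𝒞)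
    (h1 : h '' {p : ClosedAnnulus | (p.2 : ℝ) = 1} ∈ 𝒞) {U : Set S} (hU : IsOpen U)
    (hCU : h '' {p : ClosedAnnulus | (p.2 : ℝ) = 0} ⊆ U) :
    ∃ δ > 0, ∀ p : ClosedAnnulus, 0 < (p.2 : ℝ) → (p.2 : ℝ) < δ →
      ∀ D ∈ 𝒞, h p ∈ D → D ⊆ U := by
  obtain ⟨hcirc, hdisj, hcov⟩ := h𝒞
  set N : Set ClosedAnnulus := {p | 0 < (p.2 : ℝ) ∧ (p.2 : ℝ) < 1}
  have hsnd : Continuous fun p : ClosedAnnulus => (p.2 : ℝ) := by fun_prop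
  have hN : IsOpen N :=
    (isOpen_lt continuous_const hsnd).inter (isOpen_lt hsnd continuous_const)
  have hO : IsOpen (h '' N) :=
    isOpen_image_of_injective exists_planar_chart hh.continuous hh.injective hN fun p hp =>
      abs_lt.2 ⟨by linarith [hp.1], hp.2⟩
  have hin : ∀ D ∈ 𝒞, ∀ p ∈ N, h p ∈ D → D ⊆ h '' N := by
    intro D hD p hp hpD
    have hdisj' : ∀ a : ℝ, h '' {p : ClosedAnnulus | (p.2 : ℝ) = a} ∈ 𝒞 → (p.2 : ℝ) ≠ a →
        ∀ q : ClosedAnnulus, h q ∈ D → (q.2 : ℝ) ≠ a := by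
      intro a ha hpa q hq hqa
      refine disjoint_left.1 (hdisj D hD _ ha ?_) hq ⟨q, hqa, rfl⟩
      rintro rfl
      obtain ⟨p', hp', heq⟩ := hpD
      exact hpa (hh.injective heq ▸ hp')
    have hK : IsClosed (h '' {p : ClosedAnnulus | 0 ≤ (p.2 : ℝ)}) :=
      ((isClosed_le continuous_const (by fun_prop)).isCompact.image hh.continuous).isClosed
    refine (hcirc D hD).isConnected.isPreconnected.subset_left_of_subset_union hO hK.isOpen_compl
      (disjoint_compl_right_iff_subset.2 (image_mono fun q hq => hq.1.le)) ?_
      ⟨h p, hpD, p, hp, rfl⟩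
    intro x hx
    by_cases hxK : x ∈ h '' {p : ClosedAnnulus | 0 ≤ (p.2 : ℝ)}
    · obtain ⟨q, hq, rfl⟩ := hxK
      exact .inl ⟨q, ⟨hq.lt_of_ne' (hdisj' 0 h0 hp.1.ne' q hx),
        q.2.2.2.lt_of_ne (hdisj' 1 h1 hp.2.ne q hx)⟩, rfl⟩
    · exact .inr hxK
  let 𝒟 : Set (Set ℂ) := {K | ∃ D ∈ 𝒞, D ⊆ h '' N ∧ roundAnnulus '' (h ⁻¹' D) = K}
  have himg : ∀ D ⊆ h '' N, h '' (h ⁻¹' D) = D := fun D hDN =>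
    image_preimage_eq_of_subset (hDN.trans (image_subset_range _ _))
  have h𝒟 : IsSeparatingFamily 𝒟 := by
    refine ⟨?_, ?_, ?_, ?_⟩
    · rintro _ ⟨D, hD, hDN, rfl⟩
      refine IsCompact.image (hh.isCompact_iff.2 ?_) continuous_roundAnnulus
      rw [himg D hDN]
      exact (hcirc D hD).isCompact
    · rintro _ ⟨D, hD, hDN, rfl⟩
      refine IsConnected.image ?_ _ continuous_roundAnnulus.continuousOn
      have hconn := (hcirc D hD).isConnected
      rw [← himg D hDN] at hconn
      exact ⟨hconn.nonempty.of_image, hh.isInducing.isPreconnected_image.1 hconn.isPreconnected⟩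
    · rintro _ ⟨D, hD, hDN, rfl⟩ _ ⟨E, hE, hEN, rfl⟩ hne
      refine (disjoint_image_iff roundAnnulus_injective).2 ((hdisj D hD E hE ?_).preimage h)
      rintro rfl
      exact hne rfl
    · rintro _ ⟨D, hD, hDN, rfl⟩
      exact (hann D hD).not_isPreconnected_compl hh hO hDN
  obtain ⟨ε, hε, hεU⟩ := exists_forall_abs_lt_mem (hU.preimage hh.continuous)
    (image_subset_iff.1 hCU)
  obtain ⟨δ, hδ, hδε⟩ := h𝒟.exists_forall_subset_ball (by
      rintro _ ⟨D, hD, hDN, rfl⟩ _ ⟨p, hp, rfl⟩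
      obtain ⟨q, hq, hqp⟩ := hDN hp
      obtain rfl := hh.injective hqp
      rw [norm_roundAnnulus]
      exact ⟨by linarith [hq.1], by linarith [hq.2]⟩) (by
      intro z hz2 hz3
      obtain ⟨p, rfl⟩ := exists_roundAnnulus_eq (by linarith) hz3.le
      rw [norm_roundAnnulus] at hz2 hz3
      obtain ⟨D, hD, hpD⟩ := hcov.symm ▸ mem_univ (h p)
      have hpN : p ∈ N := ⟨by linarith, by linarith⟩
      exact ⟨_, ⟨D, hD, hin D hD p hpN hpD, rfl⟩, p, hpD, rfl⟩) hε
  refine ⟨min δ 1, lt_min hδ one_pos, fun p hp0 hpδ D hD hpD => ?_⟩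
  have hpN : p ∈ N := ⟨hp0, hpδ.trans_le (min_le_right _ _)⟩
  have hDN := hin D hD p hpN hpD
  intro x hx
  obtain ⟨q, hq, rfl⟩ := hDN hx
  have := hδε _ ⟨D, hD, hDN, rfl⟩ (roundAnnulus p) ⟨p, hpD, rfl⟩
    (by rw [norm_roundAnnulus]; linarith [hpδ.trans_le (min_le_left δ 1)])
    (roundAnnulus q) ⟨q, hx, rfl⟩
  rw [norm_roundAnnulus] at this
  exact hεU q (by rw [abs_of_pos hq.1]; linarith)

/-- Let `S` be a boundaryless surface and `𝒞` a circle decomposition of `S`. If every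
`C ∈ 𝒞` admits a `𝒞`-annular neighborhood, then `𝒞` is upper semicontinuous. -/
theorem annular_nbhds_implies_usc
    {S : Type*} [TopologicalSpace S] [T2Space S] [SecondCountableTopology S]
    [ConnectedSpace S] [Nonempty S] [ChartedSpace (EuclideanSpace ℝ (Fin 2)) S]
    (𝒞 : Set (Set S)) (h𝒞 : IsCircleDecomposition 𝒞)
    (hann : ∀ C ∈ 𝒞, HasAnnularNbhd 𝒞 C) :
    IsUpperSemicontinuousDecomposition 𝒞 := by
  intro C hC U hU hCU
  obtain ⟨h, hh, rfl, -, hneg, hpos⟩ := hann C hC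
  obtain ⟨δ₁, hδ₁, hup⟩ := h𝒞.exists_forall_subset_of_embedding hann hh hC hpos hU hCU
  let τ : ClosedAnnulus ≃ₜ ClosedAnnulus := (Homeomorph.refl Circle).prodCongr
    { toFun := fun t => ⟨-t, by linarith [t.2.2], by linarith [t.2.1]⟩
      invFun := fun t => ⟨-t, by linarith [t.2.2], by linarith [t.2.1]⟩
      left_inv := fun t => Subtype.ext (neg_neg _)
      right_inv := fun t => Subtype.ext (neg_neg _)
      continuous_toFun := by fun_prop
      continuous_invFun := by fun_prop }
  have hτ : ∀ p, ((τ p).2 : ℝ) = -p.2 := fun _ => rfl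
  have hττ : ∀ p, τ (τ p) = p := fun p => Prod.ext rfl (Subtype.ext (neg_neg _))
  have himg : ∀ a : ℝ, (h ∘ τ) '' {p : ClosedAnnulus | (p.2 : ℝ) = a} =
      h '' {p : ClosedAnnulus | (p.2 : ℝ) = -a} := by
    intro a
    rw [image_comp]
    congr 1
    ext p
    constructor
    · rintro ⟨q, rfl, rfl⟩
      exact hτ q
    · intro hp
      have hpa : (p.2 : ℝ) = -a := hp
      exact ⟨τ p, by rw [mem_ofPred_eq, hτ, hpa, neg_neg], hττ p⟩
  obtain ⟨δ₂, hδ₂, hdown⟩ := h𝒞.exists_forall_subset_of_embedding hann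
    (hh.comp τ.isEmbedding) (by rwa [himg, neg_zero]) (by rwa [himg]) hU (by rwa [himg, neg_zero])
  refine ⟨h '' {p | |(p.2 : ℝ)| < min (min δ₁ δ₂) 1},
    isOpen_image_of_injective exists_planar_chart hh.continuous hh.injective
      (isOpen_lt (by fun_prop) continuous_const) fun p hp => hp.trans_le (min_le_right _ _),
    image_mono fun p hp => ?_, fun D hD hDV => ?_⟩
  · have hp0 : (p.2 : ℝ) = 0 := hp
    rw [mem_ofPred_eq, hp0, abs_zero]
    exact lt_min (lt_min hδ₁ hδ₂) one_pos
  · obtain ⟨_, hpD, p, hp, rfl⟩ := nonempty_iff_ne_empty.2 hDV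
    have hp' : |(p.2 : ℝ)| < min δ₁ δ₂ := lt_of_lt_of_le hp (min_le_left _ _)
    rcases lt_trichotomy (p.2 : ℝ) 0 with hlt | heq | hgt
    · refine hdown (τ p) (by rw [hτ]; linarith) ?_ D hD (by rwa [Function.comp_apply, hττ])
      rw [hτ, ← abs_of_neg hlt]
      exact hp'.trans_le (min_le_right _ _)
    · have : D = h '' {p : ClosedAnnulus | (p.2 : ℝ) = 0} := by
        by_contra hne
        exact disjoint_left.1 (h𝒞.2.1 D hD _ hC hne) hpD ⟨p, heq, rfl⟩
      exact this ▸ hCU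
    · exact hup p hgt ((le_abs_self _).trans_lt (hp'.trans_le (min_le_left _ _))) D hD hpD
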